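/- Let f : X → ℝ be locally Lipschitz continuous, let a ∈ X with a ≠ 0, and let 0 < δ < δ'. Let (x_l)_{l≥1} and (y_l)_{l≥1} be sequences in X such that for every l: x_l − y_l = ‖x_l − y_l‖·a/‖a‖ with ‖x_l − y_l‖ > 0, the segment [x_{l+1}, y_{l+1}] is contained in [x_l, y_l], ‖y_{l+1} − x_{l+1}‖ = ½‖y_l − x_l‖, f(y_l) − f(x_l) > −δ·‖a‖·‖y_l − x_l‖, and every b ∈ ∂f((x_l+y_l)/2) satisfies ⟨a,b⟩ > δ'·‖a‖². Then (x_l) and (y_l) converge to a common limit y_∞ ∈ [x_1, y_1], there exists b ∈ ∂f(y_∞) with ⟨a,b⟩ ≤ δ·‖a‖² (in particular ⟨a,b⟩ ≤ δ'‖a‖²), there exists b'' ∈ ∂f(y_∞) with ⟨a,b''⟩ ≥ δ'·‖a‖², hence ∂f(y_∞) is not a singleton and f is not strictly differentiable at y_∞. -/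

import Mathlib

open Filter Metric Set Topology MeasureTheory
open scoped RealInnerProductSpace NNReal

variable {X : Type*} [NormedAddCommGroup X] [InnerProductSpace ℝ X] [CompleteSpace X]

/-- Clarke's generalized directional derivative. -/
noncomputable def clarkeDeriv (f : X → ℝ) (x h : X) : ℝ :=
  Filter.limsup (fun p : X × ℝ => (f (p.1 + p.2 • h) - f p.1) / p.2)
    ((𝓝 x) ×ˢ (𝓝[>] (0:ℝ)))

/-- Clarke's generalized gradient. -/
noncomputable def clarkeGrad (f : X → ℝ) (x : X) : Set X :=
  {a | ∀ h : X, ⟪a, h⟫ ≤ clarkeDeriv f x h}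

/-- The gradient of `f` on the closed ball of radius `ε` about `x`. -/
noncomputable def epsGrad (f : X → ℝ) (ε : ℝ) (x : X) : Set X :=
  closure (convexHull ℝ (⋃ y ∈ Metric.closedBall x ε, clarkeGrad f y))

/-- The directional derivative of `f` on the closed ball of radius `ε` about `x`. -/
noncomputable def epsDeriv (f : X → ℝ) (ε : ℝ) (x h : X) : ℝ :=
  sSup ((fun y => clarkeDeriv f y h) '' Metric.closedBall x ε)

section Clarke

variable {E : Type*} [NormedAddCommGroup E] [InnerProductSpace ℝ E] {f : E → ℝ} {x h : E}

theorem LocallyLipschitz.exists_eventually_abs_diffQuotient_le (hf : LocallyLipschitz f) (x : E) :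
    ∃ K : ℝ, ∀ h : E, ∀ᶠ p : E × ℝ in 𝓝 x ×ˢ 𝓝[>] (0 : ℝ),
      |(f (p.1 + p.2 • h) - f p.1) / p.2| ≤ K * ‖h‖ := by
  obtain ⟨K, s, hs, hK⟩ := hf x
  refine ⟨K, fun h => ?_⟩
  have h1 : Tendsto (fun p : E × ℝ => p.1 + p.2 • h) (𝓝 x ×ˢ 𝓝[>] (0 : ℝ)) (𝓝 x) := by
    have : Tendsto (fun p : E × ℝ => p.1 + p.2 • h) (𝓝 (x, (0 : ℝ))) (𝓝 (x + (0 : ℝ) • h)) :=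
      Continuous.tendsto (by fun_prop) (x, (0 : ℝ))
    rw [zero_smul, add_zero, nhds_prod_eq] at this
    exact this.mono_left (Filter.prod_mono le_rfl nhdsWithin_le_nhds)
  filter_upwards [h1 hs, tendsto_fst hs, tendsto_snd self_mem_nhdsWithin] with p hp1 hp2 hp3
  have hp3 : 0 < p.2 := hp3
  have hd := hK.dist_le_mul _ hp1 _ hp2
  rw [Real.dist_eq, dist_eq_norm, add_sub_cancel_left, norm_smul, Real.norm_of_nonneg hp3.le] at hd
  rw [abs_div, abs_of_pos hp3, div_le_iff₀ hp3]
  linarith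

theorem LocallyLipschitz.isBoundedUnder_diffQuotient (hf : LocallyLipschitz f) (x h : E) :
    IsBoundedUnder (· ≤ ·) (𝓝 x ×ˢ 𝓝[>] (0 : ℝ))
      (fun p : E × ℝ => (f (p.1 + p.2 • h) - f p.1) / p.2) := by
  obtain ⟨K, hK⟩ := hf.exists_eventually_abs_diffQuotient_le x
  exact isBoundedUnder_of_eventually_le ((hK h).mono fun p hp => (abs_le.1 hp).2)

theorem LocallyLipschitz.isCoboundedUnder_diffQuotient (hf : LocallyLipschitz f) (x h : E) :
    IsCoboundedUnder (· ≤ ·) (𝓝 x ×ˢ 𝓝[>] (0 : ℝ))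
      (fun p : E × ℝ => (f (p.1 + p.2 • h) - f p.1) / p.2) := by
  obtain ⟨K, hK⟩ := hf.exists_eventually_abs_diffQuotient_le x
  exact IsBoundedUnder.isCoboundedUnder_le
    (isBoundedUnder_of_eventually_ge ((hK h).mono fun p hp => (abs_le.1 hp).1))

theorem clarkeDeriv_le_of_eventually (hf : LocallyLipschitz f) {c : ℝ}
    (hc : ∀ᶠ p : E × ℝ in 𝓝 x ×ˢ 𝓝[>] (0 : ℝ), (f (p.1 + p.2 • h) - f p.1) / p.2 ≤ c) :
    clarkeDeriv f x h ≤ c :=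
  limsup_le_of_le (hf.isCoboundedUnder_diffQuotient x h) hc

theorem eventually_lt_of_clarkeDeriv_lt (hf : LocallyLipschitz f) {c : ℝ}
    (hc : clarkeDeriv f x h < c) :
    ∀ᶠ p : E × ℝ in 𝓝 x ×ˢ 𝓝[>] (0 : ℝ), (f (p.1 + p.2 • h) - f p.1) / p.2 < c :=
  eventually_lt_of_limsup_lt hc (hf.isBoundedUnder_diffQuotient x h)

theorem le_clarkeDeriv_of_frequently (hf : LocallyLipschitz f) {c : ℝ}
    (hc : ∃ᶠ p : E × ℝ in 𝓝 x ×ˢ 𝓝[>] (0 : ℝ), c ≤ (f (p.1 + p.2 • h) - f p.1) / p.2) :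
    c ≤ clarkeDeriv f x h :=
  le_limsup_of_frequently_le hc (hf.isBoundedUnder_diffQuotient x h)

theorem exists_clarkeDeriv_le_mul_norm (hf : LocallyLipschitz f) (x : E) :
    ∃ K : ℝ, ∀ h : E, clarkeDeriv f x h ≤ K * ‖h‖ := by
  obtain ⟨K, hK⟩ := hf.exists_eventually_abs_diffQuotient_le x
  exact ⟨K, fun h =>
    clarkeDeriv_le_of_eventually hf ((hK h).mono fun p hp => (abs_le.1 hp).2)⟩

theorem clarkeDeriv_zero (f : E → ℝ) (x : E) : clarkeDeriv f x 0 = 0 := by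
  simp [clarkeDeriv]

theorem clarkeDeriv_add_le (hf : LocallyLipschitz f) (x h k : E) :
    clarkeDeriv f x (h + k) ≤ clarkeDeriv f x h + clarkeDeriv f x k := by
  refine le_of_forall_pos_le_add fun ε hε => ?_
  have hh := eventually_lt_of_clarkeDeriv_lt hf
    (lt_add_of_pos_right (clarkeDeriv f x h) (half_pos hε))
  have hk := eventually_lt_of_clarkeDeriv_lt hf
    (lt_add_of_pos_right (clarkeDeriv f x k) (half_pos hε))
  have hshift : Tendsto (fun p : E × ℝ => (p.1 + p.2 • k, p.2)) (𝓝 x ×ˢ 𝓝[>] (0 : ℝ))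
      (𝓝 x ×ˢ 𝓝[>] (0 : ℝ)) := by
    refine Tendsto.prodMk ?_ tendsto_snd
    have : Tendsto (fun p : E × ℝ => p.1 + p.2 • k) (𝓝 (x, (0 : ℝ))) (𝓝 (x + (0 : ℝ) • k)) :=
      Continuous.tendsto (by fun_prop) (x, (0 : ℝ))
    rw [zero_smul, add_zero, nhds_prod_eq] at this
    exact this.mono_left (Filter.prod_mono le_rfl nhdsWithin_le_nhds)
  refine clarkeDeriv_le_of_eventually hf ?_
  filter_upwards [hshift.eventually hh, hk] with p hp1 hp2
  have e : p.1 + p.2 • (h + k) = p.1 + p.2 • k + p.2 • h := by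
    rw [smul_add]; abel
  have e2 : (f (p.1 + p.2 • (h + k)) - f p.1) / p.2 =
      (f (p.1 + p.2 • k + p.2 • h) - f (p.1 + p.2 • k)) / p.2 +
        (f (p.1 + p.2 • k) - f p.1) / p.2 := by
    rw [e]; ring
  rw [e2]
  linarith

theorem clarkeDeriv_smul_le (hf : LocallyLipschitz f) (x h : E) {c : ℝ} (hc : 0 < c) :
    clarkeDeriv f x (c • h) ≤ c * clarkeDeriv f x h := by
  refine le_of_forall_pos_le_add fun ε hε => ?_
  have hh := eventually_lt_of_clarkeDeriv_lt hf
    (lt_add_of_pos_right (clarkeDeriv f x h) (div_pos hε hc))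
  have hscale : Tendsto (fun p : E × ℝ => (p.1, p.2 * c)) (𝓝 x ×ˢ 𝓝[>] (0 : ℝ))
      (𝓝 x ×ˢ 𝓝[>] (0 : ℝ)) := by
    refine Tendsto.prodMk tendsto_fst ?_
    refine tendsto_nhdsWithin_iff.2 ⟨?_, ?_⟩
    · have : Tendsto (fun p : E × ℝ => p.2) (𝓝 x ×ˢ 𝓝[>] (0 : ℝ)) (𝓝 0) :=
        tendsto_snd.mono_right nhdsWithin_le_nhds
      simpa using this.mul_const c
    · filter_upwards [tendsto_snd self_mem_nhdsWithin] with p hp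
      exact mul_pos hp hc
  refine clarkeDeriv_le_of_eventually hf ?_
  filter_upwards [hscale.eventually hh, tendsto_snd self_mem_nhdsWithin] with p hp hp0
  have hp0 : 0 < p.2 := hp0
  have e : (f (p.1 + p.2 • c • h) - f p.1) / p.2 =
      c * ((f (p.1 + (p.2 * c) • h) - f p.1) / (p.2 * c)) := by
    rw [smul_smul]; field_simp
  rw [e]
  calc c * ((f (p.1 + (p.2 * c) • h) - f p.1) / (p.2 * c))
      ≤ c * (clarkeDeriv f x h + ε / c) := mul_le_mul_of_nonneg_left hp.le hc.le
    _ = c * clarkeDeriv f x h + ε := by field_simp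

theorem clarkeDeriv_smul (hf : LocallyLipschitz f) (x h : E) {c : ℝ} (hc : 0 < c) :
    clarkeDeriv f x (c • h) = c * clarkeDeriv f x h := by
  refine le_antisymm (clarkeDeriv_smul_le hf x h hc) ?_
  have := clarkeDeriv_smul_le hf x (c • h) (inv_pos.2 hc)
  rwa [inv_smul_smul₀ hc.ne', inv_mul_eq_div, le_div_iff₀ hc, mul_comm] at this

/-- The Clarke directional derivative is upper semicontinuous in the base point. -/
theorem le_clarkeDeriv_of_tendsto (hf : LocallyLipschitz f) {ι : Type*} {l : Filter ι} [l.NeBot]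
    {u : ι → E} (hu : Tendsto u l (𝓝 x)) {c : ℝ} (hc : ∀ i, c ≤ clarkeDeriv f (u i) h) :
    c ≤ clarkeDeriv f x h := by
  refine le_of_forall_gt_imp_ge_of_dense fun d hd => ?_
  obtain ⟨P, hP, Q, hQ, hPQ⟩ := eventually_prod_iff.1 (eventually_lt_of_clarkeDeriv_lt hf hd)
  obtain ⟨i, hi⟩ := (hu.eventually (eventually_eventually_nhds.2 hP)).exists
  exact (hc i).trans (clarkeDeriv_le_of_eventually hf
    (eventually_prod_iff.2 ⟨P, hi, Q, hQ, fun hp _ hq => (hPQ hp hq).le⟩))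

/-- The Clarke gradient attains the Clarke directional derivative. -/
theorem exists_mem_clarkeGrad_inner_eq [CompleteSpace E] (hf : LocallyLipschitz f) (x : E)
    (hh : h ≠ 0) : ∃ b ∈ clarkeGrad f x, ⟪b, h⟫ = clarkeDeriv f x h := by
  obtain ⟨g, hgh, hg⟩ := exists_extension_of_le_sublinear
    (LinearPMap.mkSpanSingleton (K := ℝ) h (clarkeDeriv f x h) hh) (clarkeDeriv f x)
    (fun c hc k => clarkeDeriv_smul hf x k hc) (clarkeDeriv_add_le hf x) (by
      rintro ⟨z, hz⟩
      obtain ⟨c, rfl⟩ := Submodule.mem_span_singleton.1 hz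
      refine (LinearPMap.mkSpanSingleton'_apply _ _ _ _ _).trans_le ?_
      change c * clarkeDeriv f x h ≤ clarkeDeriv f x (c • h)
      rcases lt_trichotomy c 0 with hc | rfl | hc
      · have h1 := clarkeDeriv_add_le hf x (c • h) ((-c) • h)
        rw [← add_smul, add_neg_cancel, zero_smul, clarkeDeriv_zero,
          clarkeDeriv_smul hf x h (neg_pos.2 hc)] at h1
        linarith
      · simp [clarkeDeriv_zero]
      · exact (clarkeDeriv_smul hf x h hc).ge)
  obtain ⟨K, hK⟩ := exists_clarkeDeriv_le_mul_norm hf x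
  have hbound : ∀ k, ‖g k‖ ≤ K * ‖k‖ := fun k => by
    refine abs_le.2 ⟨?_, (hg k).trans (hK k)⟩
    have := (hg (-k)).trans (hK (-k))
    rw [map_neg, norm_neg] at this
    linarith
  have hinner : ∀ k, ⟪(InnerProductSpace.toDual ℝ E).symm (g.mkContinuous K hbound), k⟫ = g k :=
    fun k => by simp
  refine ⟨_, fun k => (hinner k).trans_le (hg k), (hinner h).trans ?_⟩
  have := hgh ⟨h, Submodule.mem_span_singleton_self h⟩
  rw [this]
  exact LinearPMap.mkSpanSingleton_apply ℝ ℝ hh (clarkeDeriv f x h)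

theorem clarkeDeriv_eq_of_hasStrictFDerivAt {D : E →L[ℝ] ℝ} (hD : HasStrictFDerivAt f D x)
    (h : E) : clarkeDeriv f x h = D h := by
  refine Tendsto.limsup_eq ?_
  have hlim : Tendsto (fun p : E × ℝ => (p.1 + p.2 • h, p.1)) (𝓝 x ×ˢ 𝓝[>] (0 : ℝ))
      (𝓝 (x, x)) := by
    have : Tendsto (fun p : E × ℝ => (p.1 + p.2 • h, p.1)) (𝓝 (x, (0 : ℝ)))
        (𝓝 (x + (0 : ℝ) • h, x)) :=
      Continuous.tendsto (by fun_prop) (x, (0 : ℝ))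
    rw [zero_smul, add_zero, nhds_prod_eq (x := x) (y := (0 : ℝ))] at this
    exact this.mono_left (Filter.prod_mono le_rfl nhdsWithin_le_nhds)
  have ho : (fun p : E × ℝ => f (p.1 + p.2 • h) - f p.1 - D (p.1 + p.2 • h - p.1))
      =o[𝓝 x ×ˢ 𝓝[>] (0 : ℝ)] fun p : E × ℝ => p.2 := by
    refine (hD.isLittleO.comp_tendsto hlim).trans_isBigO ?_
    refine Asymptotics.IsBigO.of_bound ‖h‖ (Eventually.of_forall fun p => ?_)
    simp [norm_smul, mul_comm]
  have hz := ho.tendsto_div_nhds_zero.add_const (D h)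
  rw [zero_add] at hz
  refine hz.congr' ?_
  filter_upwards [tendsto_snd self_mem_nhdsWithin] with p hp
  have hp : p.2 ≠ 0 := ne_of_gt hp
  rw [add_sub_cancel_left, map_smul, smul_eq_mul]
  field_simp
  ring

theorem inner_eq_of_mem_clarkeGrad_of_hasStrictFDerivAt {D : E →L[ℝ] ℝ}
    (hD : HasStrictFDerivAt f D x) {b : E} (hb : b ∈ clarkeGrad f x) (h : E) :
    ⟪b, h⟫ = D h := by
  have h1 := hb h
  have h2 := hb (-h)
  rw [clarkeDeriv_eq_of_hasStrictFDerivAt hD] at h1 h2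
  rw [inner_neg_right, map_neg] at h2
  linarith

end Clarke

section NestedSegments

variable {E : Type*} [NormedAddCommGroup E]

theorem isCompact_segment [NormedSpace ℝ E] (x y : E) : IsCompact (segment ℝ x y) := by
  rw [segment_eq_image_lineMap]
  exact isCompact_Icc.image (by fun_prop)

theorem norm_sub_eq_div_two_pow {x y : ℕ → E}
    (hhalf : ∀ l, ‖y (l + 1) - x (l + 1)‖ = ‖y l - x l‖ / 2) (l : ℕ) :
    ‖x l - y l‖ = ‖x 0 - y 0‖ / 2 ^ l := by
  induction l with
  | zero => simp
  | succ l ih =>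
    rw [norm_sub_rev, hhalf, norm_sub_rev, ih, pow_succ, div_div]

/-- Nested segments whose lengths are successively halved shrink to a point. -/
theorem exists_tendsto_of_nested_segments [NormedSpace ℝ E] [CompleteSpace E] {x y : ℕ → E}
    (hseg : ∀ l, segment ℝ (x (l + 1)) (y (l + 1)) ⊆ segment ℝ (x l) (y l))
    (hhalf : ∀ l, ‖y (l + 1) - x (l + 1)‖ = ‖y l - x l‖ / 2) :
    ∃ z ∈ segment ℝ (x 0) (y 0), Tendsto x atTop (𝓝 z) ∧ Tendsto y atTop (𝓝 z) ∧
      Tendsto (fun l => ‖x l - y l‖) atTop (𝓝 0) := by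
  have hnorm := norm_sub_eq_div_two_pow hhalf
  have hcauchy : CauchySeq x := by
    refine cauchySeq_of_le_geometric_two (C := 2 * ‖x 0 - y 0‖) fun l => ?_
    have hmem := hseg l (left_mem_segment ℝ (x (l + 1)) (y (l + 1)))
    rw [segment_eq_image_lineMap] at hmem
    obtain ⟨t, ht, hxt⟩ := hmem
    rw [← hxt, dist_left_lineMap, Real.norm_of_nonneg ht.1, mul_div_cancel_left₀ _ two_ne_zero,
      ← hnorm, dist_eq_norm]
    exact mul_le_of_le_one_left (norm_nonneg _) ht.2
  obtain ⟨z, hz⟩ := cauchySeq_tendsto_of_complete hcauchy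
  have hlen : Tendsto (fun l => ‖x l - y l‖) atTop (𝓝 0) := by
    rw [funext hnorm]
    exact tendsto_const_nhds.div_atTop (tendsto_pow_atTop_atTop_of_one_lt one_lt_two)
  refine ⟨z, ?_, hz, ?_, hlen⟩
  · refine (isCompact_segment (x 0) (y 0)).isClosed.mem_of_tendsto hz
      (Eventually.of_forall fun l => ?_)
    exact antitone_nat_of_succ_le (f := fun l => segment ℝ (x l) (y l)) hseg (Nat.zero_le l)
      (left_mem_segment ℝ _ _)
  · have := hz.sub (tendsto_zero_iff_norm_tendsto_zero.2 hlen)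
    simp only [sub_sub_cancel, sub_zero] at this
    exact this

end NestedSegments

/-- Proposition 3.5(3): if the bisection subalgorithm does not terminate, the nested
segments shrink to a point `y∞` where `∂f(y∞)` contains elements on both sides of the
threshold, hence `∂f(y∞)` is not a singleton and `f` is not strictly differentiable there. -/
theorem bisection_nontermination_limit
    (f : X → ℝ) (hf : LocallyLipschitz f)
    (a : X) (ha : a ≠ 0) (δ δ' : ℝ) (hδ : 0 < δ) (hδδ' : δ < δ')
    (x y : ℕ → X)
    (hdir : ∀ l, x l - y l = (‖x l - y l‖ / ‖a‖) • a)
    (hpos : ∀ l, 0 < ‖x l - y l‖)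
    (hseg : ∀ l, segment ℝ (x (l+1)) (y (l+1)) ⊆ segment ℝ (x l) (y l))
    (hhalf : ∀ l, ‖y (l+1) - x (l+1)‖ = ‖y l - x l‖ / 2)
    (hviol : ∀ l, f (y l) - f (x l) > -δ * ‖a‖ * ‖y l - x l‖)
    (hmid : ∀ l, ∀ b ∈ clarkeGrad f (midpoint ℝ (x l) (y l)), δ' * ‖a‖ ^ 2 < ⟪a, b⟫) :
    ∃ yinf : X,
      Tendsto x atTop (𝓝 yinf) ∧ Tendsto y atTop (𝓝 yinf) ∧
      yinf ∈ segment ℝ (x 0) (y 0) ∧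
      (∃ b ∈ clarkeGrad f yinf, ⟪a, b⟫ ≤ δ * ‖a‖ ^ 2) ∧
      (∃ b'' ∈ clarkeGrad f yinf, δ' * ‖a‖ ^ 2 ≤ ⟪a, b''⟫) ∧
      (¬ ∃ c : X, clarkeGrad f yinf = {c}) ∧
      (¬ ∃ D : X →L[ℝ] ℝ, HasStrictFDerivAt f D yinf) := by
  have ha' : 0 < ‖a‖ := norm_pos_iff.2 ha
  obtain ⟨z, hz, hxz, hyz, hlen⟩ := exists_tendsto_of_nested_segments hseg hhalf
  have hlow : -(δ * ‖a‖ ^ 2) ≤ clarkeDeriv f z (-a) := by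
    have hstep : Tendsto (fun l => (x l, ‖x l - y l‖ / ‖a‖)) atTop (𝓝 z ×ˢ 𝓝[>] (0 : ℝ)) := by
      refine hxz.prodMk (tendsto_nhdsWithin_iff.2 ⟨?_, ?_⟩)
      · simpa using hlen.div_const ‖a‖
      · exact Eventually.of_forall fun l => div_pos (hpos l) ha'
    refine le_clarkeDeriv_of_frequently hf (hstep.frequently (Frequently.of_forall fun l => ?_))
    have hy : x l + (‖x l - y l‖ / ‖a‖) • -a = y l := by
      rw [smul_neg, ← hdir l]; abel
    have hv := hviol l
    rw [norm_sub_rev] at hv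
    simp only [hy]
    rw [le_div_iff₀ (div_pos (hpos l) ha')]
    calc -(δ * ‖a‖ ^ 2) * (‖x l - y l‖ / ‖a‖) = -δ * ‖a‖ * ‖x l - y l‖ := by field_simp
      _ ≤ f (y l) - f (x l) := hv.le
  have hhigh : δ' * ‖a‖ ^ 2 ≤ clarkeDeriv f z a := by
    have hmidz : Tendsto (fun l => midpoint ℝ (x l) (y l)) atTop (𝓝 z) := by
      have := (hxz.add hyz).const_smul (2⁻¹ : ℝ)
      simp only [midpoint_eq_smul_add, invOf_eq_inv]
      rwa [← two_smul ℝ z, inv_smul_smul₀ two_ne_zero] at this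
    refine le_clarkeDeriv_of_tendsto hf hmidz fun l => ?_
    obtain ⟨b, hb, hba⟩ := exists_mem_clarkeGrad_inner_eq hf (midpoint ℝ (x l) (y l)) ha
    rw [← hba, real_inner_comm]
    exact (hmid l b hb).le
  obtain ⟨b, hb, hba⟩ := exists_mem_clarkeGrad_inner_eq hf z (neg_ne_zero.2 ha)
  obtain ⟨b', hb', hba'⟩ := exists_mem_clarkeGrad_inner_eq hf z ha
  have hble : ⟪a, b⟫ ≤ δ * ‖a‖ ^ 2 := by
    rw [← hba, inner_neg_right, real_inner_comm] at hlow
    linarith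
  have hble' : δ' * ‖a‖ ^ 2 ≤ ⟪a, b'⟫ := by
    rwa [real_inner_comm, hba']
  have hlt : ⟪a, b⟫ < ⟪a, b'⟫ :=
    hble.trans_lt ((mul_lt_mul_of_pos_right hδδ' (by positivity)).trans_le hble')
  refine ⟨z, hxz, hyz, hz, ⟨b, hb, hble⟩, ⟨b', hb', hble'⟩, ?_, ?_⟩
  · rintro ⟨c, hc⟩
    rw [hc, mem_singleton_iff] at hb hb'
    rw [hb, hb'] at hlt
    exact hlt.false
  · rintro ⟨D, hD⟩
    rw [real_inner_comm, real_inner_comm b' a,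
      inner_eq_of_mem_clarkeGrad_of_hasStrictFDerivAt hD hb,
      inner_eq_of_mem_clarkeGrad_of_hasStrictFDerivAt hD hb'] at hlt
    exact hlt.false
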